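/- Let H be a complex Hilbert space and T ∈ B(H). Suppose T is absolutely minimum attaining: for every nonzero closed subspace M of H, the restriction T|_M : M → H attains its minimum modulus, i.e., there exists x ∈ M with ‖x‖ = 1 and ‖Tx‖ = inf { ‖Ty‖ : y ∈ M, ‖y‖ = 1 }. Then the range of T is a closed subspace of H. -/

import Mathlib

/-- A bounded operator that is bounded below on the orthogonal complement of its kernel
has closed range. -/
theorem ContinuousLinearMap.isClosed_range_of_bddBelow_orthogonal_ker {𝕜 H F : Type*} [RCLike 𝕜]
    [NormedAddCommGroup H] [InnerProductSpace 𝕜 H] [CompleteSpace H]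
    [NormedAddCommGroup F] [NormedSpace 𝕜 F] (T : H →L[𝕜] F) {c : ℝ} (hc : 0 < c)
    (h : ∀ y ∈ (T.ker)ᗮ, c * ‖y‖ ≤ ‖T y‖) : IsClosed (Set.range fun x => T x) := by
  have hker : IsClosed (T.ker : Set H) := T.isClosed_ker
  have : CompleteSpace T.ker := hker.completeSpace_coe
  let S : (T.ker)ᗮ →L[𝕜] F := T.comp (T.ker)ᗮ.subtypeL
  have hS : AntilipschitzWith (c⁻¹).toNNReal S := by
    refine AddMonoidHomClass.antilipschitz_of_bound S fun y => ?_
    rw [Real.coe_toNNReal _ (inv_nonneg.2 hc.le), inv_mul_eq_div, le_div_iff₀' hc]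
    exact h y y.2
  have hrange : Set.range (fun x => T x) = Set.range S := by
    refine Set.Subset.antisymm ?_ ?_
    · rintro _ ⟨x, rfl⟩
      obtain ⟨u, hu, v, hv, rfl⟩ := T.ker.exists_add_mem_mem_orthogonal x
      have hTu : T u = 0 := hu
      exact ⟨⟨v, hv⟩, by simp [S, hTu]⟩
    · rintro _ ⟨y, rfl⟩
      exact ⟨y, rfl⟩
  rw [hrange]
  exact hS.isClosed_range S.uniformContinuous

/-- An absolutely minimum attaining operator on a complex Hilbert space has closed range. -/
theorem stmt_12 {H : Type*} [NormedAddCommGroup H] [InnerProductSpace ℂ H] [CompleteSpace H]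
    (T : H →L[ℂ] H)
    (hAM : ∀ M : Submodule ℂ H, IsClosed (M : Set H) → M ≠ ⊥ →
      ∃ x ∈ M, ‖x‖ = 1 ∧ ‖T x‖ = sInf {r : ℝ | ∃ y ∈ M, ‖y‖ = 1 ∧ r = ‖T y‖}) :
    IsClosed (Set.range fun x => T x) := by
  by_cases hM : (T.ker)ᗮ = ⊥
  · refine T.isClosed_range_of_bddBelow_orthogonal_ker one_pos fun y hy => ?_
    rw [hM, Submodule.mem_bot] at hy
    simp [hy]
  obtain ⟨x, hx, hx1, hmin⟩ := hAM _ (T.ker).isClosed_orthogonal hM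
  have hTx : T x ≠ 0 := fun h0 => by
    have : x = 0 := by
      simpa using (T.ker).inner_right_of_mem_orthogonal (show x ∈ T.ker from h0) hx
    simp [this] at hx1
  refine T.isClosed_range_of_bddBelow_orthogonal_ker (norm_pos_iff.2 hTx) fun y hy => ?_
  rcases eq_or_ne y 0 with rfl | hy0
  · simp
  have hle : ‖T x‖ ≤ ‖T (((‖y‖⁻¹ : ℝ) : ℂ) • y)‖ := by
    rw [hmin]
    refine csInf_le ⟨0, ?_⟩ ⟨_, Submodule.smul_mem _ _ hy, ?_, rfl⟩
    · rintro _ ⟨z, -, -, rfl⟩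
      exact norm_nonneg _
    · simp [norm_smul, hy0]
  rw [map_smul, norm_smul, Complex.norm_real, norm_inv, norm_norm, inv_mul_eq_div,
    le_div_iff₀ (norm_pos_iff.2 hy0)] at hle
  exact hle
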